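/- arXiv:1411.6277 — 2 statements merged into one kernel-verified Lean document; each statement's English description precedes it below -/
import Mathlib

section
/- Let V be a Banach space, d ≥ 1, p ≥ 1, and δ ∈ (0,1]. Let f : ℝ^d → V be measurable with |f|_{δ,p;V} := ( ∫_{ℝ^d} |f(x)|_V^p dx + ∫∫_{|x−y|<1} |f(x) − f(y)|_V^p / |x−y|^{2d+δp} dx dy )^{1/p} < ∞. Then f has a modification (equal to f almost everywhere) belonging to C^δ(ℝ^d;V), and there is a constant N = N(d,δ,p), independent of f, such that this modification satisfies |f|_{δ;V} ≤ N |f|_{δ,p;V}. -/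
open MeasureTheory ENNReal

universe u

open Filter Topology

section Averages

variable {α V : Type*} [MeasurableSpace α] [NormedAddCommGroup V] [NormedSpace ℝ V]
  [CompleteSpace V] {μ : Measure α} {f : α → V} {p : ℝ}

/-- Jensen's inequality for the `p`-th power of the distance from the mean to a fixed vector. -/
lemma enorm_integral_sub_rpow_le_lintegral [IsProbabilityMeasure μ] (hp : 1 ≤ p)
    (hf : Integrable f μ) (c : V) :
    ‖∫ x, f x ∂μ - c‖ₑ ^ p ≤ ∫⁻ x, ‖f x - c‖ₑ ^ p ∂μ := by
  have hp0 : 0 < p := zero_lt_one.trans_le hp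
  have hmean : ∫ x, f x ∂μ - c = ∫ x, (f x - c) ∂μ := by
    rw [integral_sub hf (integrable_const c)]
    simp
  have hmono := eLpNorm_le_eLpNorm_of_exponent_le (μ := μ) (f := fun x => f x - c)
    (p := 1) (q := ENNReal.ofReal p) (by simpa using ENNReal.ofReal_le_ofReal hp)
    (hf.sub (integrable_const c)).aestronglyMeasurable
  rw [eLpNorm_one_eq_lintegral_enorm, eLpNorm_eq_lintegral_rpow_enorm_toReal (by simpa using hp0)
    ENNReal.ofReal_ne_top, ENNReal.toReal_ofReal hp0.le, one_div] at hmono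
  rw [hmean]
  exact (ENNReal.le_rpow_inv_iff hp0).1 ((enorm_integral_le_lintegral_enorm _).trans hmono)

lemma enorm_setAverage_sub_rpow_le (hp : 1 ≤ p) {s : Set α} (hs0 : μ s ≠ 0) (hs : μ s ≠ ∞)
    (hf : IntegrableOn f s μ) (c : V) :
    ‖⨍ x in s, f x ∂μ - c‖ₑ ^ p ≤ (μ s)⁻¹ * ∫⁻ x in s, ‖f x - c‖ₑ ^ p ∂μ := by
  have hprob : IsProbabilityMeasure ((μ s)⁻¹ • μ.restrict s) :=
    ⟨by simp [ENNReal.inv_mul_cancel hs0 hs]⟩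
  have h := enorm_integral_sub_rpow_le_lintegral hp
    (hf.integrable.smul_measure (ENNReal.inv_ne_top.2 hs0)) c
  rwa [lintegral_smul_measure, ← setAverage_eq', smul_eq_mul] at h

lemma enorm_setAverage_sub_setAverage_rpow_le (hp : 1 ≤ p) {s t : Set α}
    (hs0 : μ s ≠ 0) (hs : μ s ≠ ∞) (ht0 : μ t ≠ 0) (ht : μ t ≠ ∞)
    (hfs : IntegrableOn f s μ) (hft : IntegrableOn f t μ) :
    ‖⨍ x in s, f x ∂μ - ⨍ y in t, f y ∂μ‖ₑ ^ p ≤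
      (μ s)⁻¹ * ((μ t)⁻¹ * ∫⁻ x in s, ∫⁻ y in t, ‖f x - f y‖ₑ ^ p ∂μ ∂μ) := by
  refine (enorm_setAverage_sub_rpow_le hp hs0 hs hfs _).trans ?_
  rw [← lintegral_const_mul' _ _ (ENNReal.inv_ne_top.2 ht0)]
  gcongr with x
  rw [← enorm_neg, neg_sub]
  refine (enorm_setAverage_sub_rpow_le hp ht0 ht hft _).trans_eq ?_
  congr 2 with y
  rw [← enorm_neg, neg_sub]

end Averages

/-- The energy between two sets at mutual distance less than one is controlled by the
truncated Gagliardo energy. -/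
lemma lintegral_lintegral_enorm_sub_rpow_le {E V : Type*} [NormedAddCommGroup E]
    [MeasurableSpace E] [OpensMeasurableSpace E] [NormedAddCommGroup V] {μ : Measure E} {f : E → V}
    {p e ρ : ℝ} (hp : 0 < p) (he : 0 ≤ e) (hρ : ρ < 1) {s t : Set E}
    (hs : MeasurableSet s) (ht : MeasurableSet t)
    (hst : ∀ x ∈ s, ∀ y ∈ t, ‖x - y‖ ≤ ρ) :
    ∫⁻ x in s, ∫⁻ y in t, ‖f x - f y‖ₑ ^ p ∂μ ∂μ ≤
      ENNReal.ofReal ρ ^ e *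
        ∫⁻ x, ∫⁻ y in Metric.ball x 1, ‖f x - f y‖ₑ ^ p / ‖x - y‖ₑ ^ e ∂μ ∂μ := by
  have hρ' : ENNReal.ofReal ρ ^ e ≠ ∞ := ENNReal.rpow_ne_top_of_nonneg he ENNReal.ofReal_ne_top
  rw [← lintegral_const_mul' _ _ hρ']
  refine (setLIntegral_mono' hs fun x hx => ?_).trans (setLIntegral_le_lintegral s _)
  rw [← lintegral_const_mul' _ _ hρ']
  refine (setLIntegral_mono' ht fun y hy => ?_).trans
    (lintegral_mono_set (fun y hy => ?_ : t ⊆ Metric.ball x 1))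
  · rcases eq_or_ne x y with rfl | hxy
    · simp [hp]
    have h0 : ‖x - y‖ₑ ≠ 0 := by simpa [sub_eq_zero] using hxy
    have h1 : ‖x - y‖ₑ ^ e ≠ 0 := by simp [ENNReal.rpow_eq_zero_iff, h0]
    have h2 : ‖x - y‖ₑ ^ e ≠ ∞ := ENNReal.rpow_ne_top_of_nonneg he enorm_ne_top
    calc ‖f x - f y‖ₑ ^ p
        = ‖x - y‖ₑ ^ e * (‖f x - f y‖ₑ ^ p / ‖x - y‖ₑ ^ e) :=
          (ENNReal.mul_div_cancel h1 h2).symm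
      _ ≤ ENNReal.ofReal ρ ^ e * (‖f x - f y‖ₑ ^ p / ‖x - y‖ₑ ^ e) := by
          gcongr
          rw [← ofReal_norm]
          exact ENNReal.ofReal_le_ofReal (hst x hx y hy)
  · rw [Metric.mem_ball, dist_comm, dist_eq_norm]
    exact (hst x hx y hy).trans_lt hρ

/-- Approximations that vary geometrically over dyadic scales converge to a Hölder function. -/
lemma exists_tendsto_holder_of_dyadic {E V : Type*} [SeminormedAddCommGroup E]
    [NormedAddCommGroup V] [CompleteSpace V] {F : ℕ → E → V} {δ M K : ℝ} (hδ : 0 < δ)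
    (hM : 0 ≤ M) (hK : ∀ x, ‖F 0 x‖ ≤ K)
    (hF : ∀ k x y, ‖x - y‖ ≤ 1 / 4 * (1 / 2) ^ k →
      ‖F k x - F (k + 1) y‖ ≤ M * ((1 / 2 : ℝ) ^ δ) ^ k) :
    ∃ g : E → V, (∀ x, Tendsto (fun k => F k x) atTop (𝓝 (g x))) ∧
      (∀ x, ‖g x‖ ≤ K + M / (1 - (1 / 2) ^ δ)) ∧
      ∀ x y, ‖g x - g y‖ ≤
        8 ^ δ * (2 * K + M + 2 * (M / (1 - (1 / 2) ^ δ))) * ‖x - y‖ ^ δ := by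
  set q : ℝ := (1 / 2) ^ δ with hq
  have hq0 : 0 < q := by positivity
  have hq1 : q < 1 := Real.rpow_lt_one (by norm_num) (by norm_num) hδ
  set L := M / (1 - q) with hL
  have hL0 : 0 ≤ L := div_nonneg hM (sub_nonneg.2 hq1.le)
  have hdist : ∀ x n, dist (F n x) (F (n + 1) x) ≤ M * q ^ n := fun x n => by
    rw [dist_eq_norm]
    exact hF n x x (by simp)
  choose g hg using fun x =>
    cauchySeq_tendsto_of_complete (cauchySeq_of_le_geometric q M hq1 (hdist x))
  have hgF : ∀ n x, ‖F n x - g x‖ ≤ L * q ^ n := fun n x => by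
    rw [← dist_eq_norm, hL, div_mul_eq_mul_div]
    exact dist_le_of_le_geometric_of_tendsto q M hq1 (hdist x) (hg x) n
  have hsup : ∀ x, ‖g x‖ ≤ K + L := fun x => by
    have h := hgF 0 x
    have h' := norm_sub_norm_le (g x) (F 0 x)
    rw [norm_sub_rev] at h'
    have := hK x
    simp only [pow_zero, mul_one] at h
    linarith
  refine ⟨g, hg, hsup, fun x y => ?_⟩
  have hK0 : 0 ≤ K := (norm_nonneg _).trans (hK x)
  rw [mul_right_comm, ← Real.mul_rpow (by norm_num) (norm_nonneg _), mul_comm]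
  rcases (norm_nonneg (x - y)).eq_or_lt with h0 | h0
  · have hlim : ‖g x - g y‖ ≤ 0 := by
      refine le_of_tendsto_of_tendsto ((hg x).sub ((hg y).comp (tendsto_add_atTop_nat 1))).norm
        (by simpa using (tendsto_pow_atTop_nhds_zero_of_lt_one hq0.le hq1).const_mul M)
        (Eventually.of_forall fun k => hF k x y (h0 ▸ by positivity))
    exact hlim.trans (by positivity)
  rcases le_or_gt (4 * ‖x - y‖) 1 with h1 | h1
  · obtain ⟨n, hn, hn'⟩ := exists_nat_pow_near_of_lt_one (x := 4 * ‖x - y‖) (y := (1 / 2 : ℝ))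
      (by positivity) h1 (by norm_num) (by norm_num)
    have hqn : q ^ n ≤ (8 * ‖x - y‖) ^ δ := by
      rw [hq, Real.rpow_pow_comm (by norm_num)]
      refine Real.rpow_le_rpow (by positivity) ?_ hδ.le
      rw [pow_succ] at hn
      linarith
    have hqn' : L * q ^ (n + 1) ≤ L * q ^ n :=
      mul_le_mul_of_nonneg_left (pow_le_pow_of_le_one hq0.le hq1.le n.le_succ) hL0
    have e1 := hgF n x
    rw [norm_sub_rev] at e1
    have e2 := hF n x y (by linarith)
    have e3 := (hgF (n + 1) y).trans hqn'
    calc ‖g x - g y‖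
        = ‖(g x - F n x) + (F n x - F (n + 1) y) + (F (n + 1) y - g y)‖ := by congr 1; abel
      _ ≤ L * q ^ n + M * q ^ n + L * q ^ n := (norm_add₃_le).trans (by linarith)
      _ = (M + 2 * L) * q ^ n := by ring
      _ ≤ (2 * K + M + 2 * L) * (8 * ‖x - y‖) ^ δ := by
          gcongr
          linarith
  · have h8 : 1 ≤ (8 * ‖x - y‖) ^ δ := Real.one_le_rpow (by linarith) hδ.le
    calc ‖g x - g y‖ ≤ ‖g x‖ + ‖g y‖ := norm_sub_le _ _
      _ ≤ (2 * K + M + 2 * L) * 1 := by linarith [hsup x, hsup y]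
      _ ≤ (2 * K + M + 2 * L) * (8 * ‖x - y‖) ^ δ := by gcongr

/-- A bound on `p`-th powers in `ℝ≥0∞` as a bound on norms. -/
lemma norm_le_rpow_mul_rpow_of_enorm_rpow_le {V : Type*} [NormedAddCommGroup V] {v : V}
    {p B b : ℝ} {A : ℝ≥0∞} (hp : 0 < p) (hB : 0 ≤ B) (hb : 0 ≤ b) (hA : A ≠ ∞)
    (h : ‖v‖ₑ ^ p ≤ ENNReal.ofReal (B * b ^ p) * A) :
    ‖v‖ ≤ B ^ (1 / p) * b * A.toReal ^ (1 / p) := by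
  have h' := ENNReal.toReal_mono (ENNReal.mul_ne_top ENNReal.ofReal_ne_top hA) h
  rw [← ENNReal.toReal_rpow, toReal_enorm, ENNReal.toReal_mul,
    ENNReal.toReal_ofReal (by positivity)] at h'
  have hAr : 0 ≤ A.toReal := ENNReal.toReal_nonneg
  calc ‖v‖ = (‖v‖ ^ p) ^ (1 / p) := by
        rw [← Real.rpow_mul (norm_nonneg v), mul_one_div_cancel hp.ne', Real.rpow_one]
    _ ≤ (B * b ^ p * A.toReal) ^ (1 / p) := by gcongr
    _ = B ^ (1 / p) * b * A.toReal ^ (1 / p) := by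
        rw [Real.mul_rpow (by positivity) hAr, Real.mul_rpow hB (by positivity),
          ← Real.rpow_mul hb, mul_one_div_cancel hp.ne', Real.rpow_one]

section EuclideanBalls

variable {E V : Type*} [NormedAddCommGroup E] [NormedSpace ℝ E] [FiniteDimensional ℝ E]
  [MeasurableSpace E] [BorelSpace E] {μ : Measure E} [μ.IsAddHaarMeasure]
  [NormedAddCommGroup V] [NormedSpace ℝ V] [CompleteSpace V] {f : E → V} {p : ℝ}

lemma inv_measure_closedBall (x : E) {r : ℝ} (hr : 0 < r) :
    (μ (Metric.closedBall x r))⁻¹ =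
      ENNReal.ofReal (r ^ Module.finrank ℝ E * μ.real (Metric.ball 0 1))⁻¹ := by
  have hω : 0 < μ.real (Metric.ball (0 : E) 1) :=
    ENNReal.toReal_pos (Metric.measure_ball_pos μ _ one_pos).ne' measure_ball_lt_top.ne
  rw [ENNReal.ofReal_inv_of_pos (by positivity), ← Measure.addHaar_real_closedBall μ x hr.le,
    ofReal_measureReal measure_closedBall_lt_top.ne]

lemma norm_setAverage_closedBall_le (hp : 1 ≤ p) (hf : LocallyIntegrable f μ) {A : ℝ≥0∞}
    (hA : A ≠ ∞) (hfA : ∫⁻ x, ‖f x‖ₑ ^ p ∂μ ≤ A) (x : E) {r : ℝ} (hr : 0 < r) :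
    ‖⨍ y in Metric.closedBall x r, f y ∂μ‖ ≤
      ((r ^ Module.finrank ℝ E * μ.real (Metric.ball 0 1))⁻¹) ^ (1 / p) * A.toReal ^ (1 / p) := by
  have hp0 : 0 < p := zero_lt_one.trans_le hp
  have h := enorm_setAverage_sub_rpow_le hp
    (Metric.measure_closedBall_pos μ x hr).ne' measure_closedBall_lt_top.ne
    (hf.integrableOn_isCompact (isCompact_closedBall x r)) 0
  simp only [sub_zero] at h
  rw [inv_measure_closedBall x hr] at h
  have h1 := norm_le_rpow_mul_rpow_of_enorm_rpow_le (A := A) (b := 1)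
    (B := (r ^ Module.finrank ℝ E * μ.real (Metric.ball (0 : E) 1))⁻¹) hp0 (by positivity)
    zero_le_one hA
    (by
      rw [Real.one_rpow, mul_one]
      exact h.trans (by gcongr; exact (setLIntegral_le_lintegral _ _).trans hfA))
  simpa using h1

lemma norm_setAverage_closedBall_sub_le {δ : ℝ} (hp : 1 ≤ p) (hδ : 0 ≤ δ)
    (hf : LocallyIntegrable f μ) {A : ℝ≥0∞} (hA : A ≠ ∞)
    (hfA : ∫⁻ x, ∫⁻ y in Metric.ball x 1,
      ‖f x - f y‖ₑ ^ p / ‖x - y‖ₑ ^ (2 * (Module.finrank ℝ E : ℝ) + δ * p) ∂μ ∂μ ≤ A)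
    {x y : E} {r : ℝ} (hr : 0 < r) (hr' : r ≤ 1 / 4) (hxy : ‖x - y‖ ≤ r) :
    ‖⨍ z in Metric.closedBall x r, f z ∂μ - ⨍ z in Metric.closedBall y (r / 2), f z ∂μ‖ ≤
      (2 ^ Module.finrank ℝ E * 3 ^ (2 * (Module.finrank ℝ E : ℝ) + δ * p) /
        μ.real (Metric.ball (0 : E) 1) ^ 2) ^ (1 / p) * r ^ δ * A.toReal ^ (1 / p) := by
  have hp0 : 0 < p := zero_lt_one.trans_le hp
  have hr2 : 0 < r / 2 := half_pos hr
  set n := Module.finrank ℝ E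
  have he : 0 ≤ 2 * (n : ℝ) + δ * p := by positivity
  have hω : 0 < μ.real (Metric.ball (0 : E) 1) :=
    ENNReal.toReal_pos (Metric.measure_ball_pos μ _ one_pos).ne' measure_ball_lt_top.ne
  have h := enorm_setAverage_sub_setAverage_rpow_le hp
    (Metric.measure_closedBall_pos μ x hr).ne' measure_closedBall_lt_top.ne
    (Metric.measure_closedBall_pos μ y hr2).ne' measure_closedBall_lt_top.ne
    (hf.integrableOn_isCompact (isCompact_closedBall x r))
    (hf.integrableOn_isCompact (isCompact_closedBall y (r / 2)))
  have h2 := lintegral_lintegral_enorm_sub_rpow_le (μ := μ) (f := f) (ρ := 3 * r) hp0 he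
    (by linarith) (Metric.isClosed_closedBall (x := x) (ε := r)).measurableSet
    (Metric.isClosed_closedBall (x := y) (ε := r / 2)).measurableSet
    (fun u hu v hv => by
      rw [mem_closedBall_iff_norm] at hu
      rw [mem_closedBall_iff_norm'] at hv
      calc ‖u - v‖ = ‖(u - x) + (x - y) + (y - v)‖ := by congr 1; abel
        _ ≤ 3 * r := norm_add₃_le.trans (by linarith))
  refine norm_le_rpow_mul_rpow_of_enorm_rpow_le hp0 (by positivity) (by positivity) hA ?_
  rw [inv_measure_closedBall x hr, inv_measure_closedBall y hr2] at h
  refine h.trans ?_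
  calc _ ≤ ENNReal.ofReal (r ^ n * μ.real (Metric.ball (0 : E) 1))⁻¹ *
        (ENNReal.ofReal ((r / 2) ^ n * μ.real (Metric.ball (0 : E) 1))⁻¹ *
          (ENNReal.ofReal (3 * r) ^ (2 * (n : ℝ) + δ * p) * A)) := by
        gcongr
        exact h2.trans (by gcongr)
    _ = _ := by
        rw [ENNReal.ofReal_rpow_of_nonneg (by positivity) he, ← mul_assoc, ← mul_assoc,
          ← ENNReal.ofReal_mul (by positivity), ← ENNReal.ofReal_mul (by positivity)]
        congr 2
        rw [Real.mul_rpow (by norm_num) hr.le, Real.rpow_add hr (2 * (n : ℝ)),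
          Real.rpow_mul hr.le δ p, mul_comm 2 (n : ℝ), Real.rpow_mul hr.le, Real.rpow_natCast, Real.rpow_two]
        field_simp
        rw [← mul_pow, div_mul_cancel₀ r two_ne_zero]

end EuclideanBalls

/-- Sobolev-type embedding on the whole space `ℝ^d`.
If `f : ℝ^d → V` is measurable with
`|f|_{δ,p;V} = (∫ ‖f‖^p + ∫∫_{|x−y|<1} ‖f x − f y‖^p/|x−y|^{2d+δp})^{1/p} < ∞`,
then `f` has a modification `g ∈ C^δ(ℝ^d; V)` with `|g|_{δ;V} ≤ N |f|_{δ,p;V}`,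
where `N = N(d,δ,p)` is independent of `f`.  The Hölder norm
`|g|_{δ;V} = sup ‖g‖ + [g]_δ` is encoded by constants `C`, `H` bounding the sup norm
and the Hölder seminorm with `C + H ≤ N |f|_{δ,p;V}`. -/
theorem stmt_1 (d : ℕ) (hd : 1 ≤ d) (p δ : ℝ) (hp : 1 ≤ p) (hδ : δ ∈ Set.Ioc (0 : ℝ) 1) :
    ∃ N : ℝ, 0 < N ∧
      ∀ (V : Type u) [NormedAddCommGroup V] [NormedSpace ℝ V] [CompleteSpace V]
        (f : EuclideanSpace ℝ (Fin d) → V), StronglyMeasurable f →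
        (∫⁻ x, (‖f x‖₊ : ℝ≥0∞) ^ p ∂volume) +
          (∫⁻ x, ∫⁻ y in Metric.ball x 1,
            (‖f x - f y‖₊ : ℝ≥0∞) ^ p / (‖x - y‖₊ : ℝ≥0∞) ^ (2 * (d : ℝ) + δ * p)
            ∂volume ∂volume) ≠ ⊤ →
        ∃ g : EuclideanSpace ℝ (Fin d) → V,
          g =ᵐ[volume] f ∧ Continuous g ∧
          ∃ C H : ℝ,
            (∀ x, ‖g x‖ ≤ C) ∧
            (∀ x y, ‖g x - g y‖ ≤ H * ‖x - y‖ ^ δ) ∧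
            C + H ≤ N *
              (((∫⁻ x, (‖f x‖₊ : ℝ≥0∞) ^ p ∂volume) +
                (∫⁻ x, ∫⁻ y in Metric.ball x 1,
                  (‖f x - f y‖₊ : ℝ≥0∞) ^ p / (‖x - y‖₊ : ℝ≥0∞) ^ (2 * (d : ℝ) + δ * p)
                  ∂volume ∂volume)).toReal) ^ (1 / p) := by
  have hp0 : 0 < p := zero_lt_one.trans_le hp
  obtain ⟨hδ0, -⟩ := hδ
  set ω := (volume : Measure (EuclideanSpace ℝ (Fin d))).real (Metric.ball 0 1)
  set m : ℝ := (2 ^ d * 3 ^ (2 * (d : ℝ) + δ * p) / ω ^ 2) ^ (1 / p)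
  set κ : ℝ := (((1 / 4) ^ d * ω)⁻¹) ^ (1 / p)
  set q : ℝ := (1 / 2) ^ δ
  have hq1 : 0 < 1 - q := sub_pos.2 (Real.rpow_lt_one (by norm_num) (by norm_num) hδ0)
  have hm0 : 0 ≤ m := by positivity
  have hκ0 : 0 ≤ κ := by positivity
  refine ⟨κ + m / (1 - q) + 8 ^ δ * (2 * κ + m + 2 * (m / (1 - q))) + 1, by positivity, ?_⟩
  intro V _ _ _ f hf hfin
  set A : ℝ≥0∞ := (∫⁻ x, (‖f x‖₊ : ℝ≥0∞) ^ p ∂volume) +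
    (∫⁻ x, ∫⁻ y in Metric.ball x 1,
      (‖f x - f y‖₊ : ℝ≥0∞) ^ p / (‖x - y‖₊ : ℝ≥0∞) ^ (2 * (d : ℝ) + δ * p)
      ∂volume ∂volume)
  have hA1 : ∫⁻ x, ‖f x‖ₑ ^ p ≤ A := le_self_add
  have hA2 : ∫⁻ x, ∫⁻ y in Metric.ball x 1, ‖f x - f y‖ₑ ^ p /
      ‖x - y‖ₑ ^ (2 * (Module.finrank ℝ (EuclideanSpace ℝ (Fin d)) : ℝ) + δ * p) ≤ A := by
    rw [finrank_euclideanSpace_fin]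
    exact le_add_self
  have hloc : LocallyIntegrable f := by
    refine MemLp.locallyIntegrable (p := ENNReal.ofReal p) ⟨hf.aestronglyMeasurable, ?_⟩
      (by simpa using ENNReal.ofReal_le_ofReal hp)
    rw [eLpNorm_lt_top_iff_lintegral_rpow_enorm_lt_top (by simpa using hp0)
      ENNReal.ofReal_ne_top, ENNReal.toReal_ofReal hp0.le]
    exact hA1.trans_lt hfin.lt_top
  set a := A.toReal ^ (1 / p)
  have ha : 0 ≤ a := by positivity
  obtain ⟨g, hg, hsup, hhol⟩ := exists_tendsto_holder_of_dyadic (δ := δ) (M := m * a)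
    (K := κ * a)
    (F := fun k x => ⨍ y in Metric.closedBall x (1 / 4 * (1 / 2) ^ k), f y) hδ0 (by positivity)
    (fun x => by
      have h := norm_setAverage_closedBall_le hp hloc hfin hA1 x (r := 1 / 4) (by norm_num)
      rw [finrank_euclideanSpace_fin] at h
      simpa only [pow_zero, mul_one] using h)
    (fun k x y hxy => by
      have hk : (1 / 2 : ℝ) ^ k ≤ 1 := pow_le_one₀ (by norm_num) (by norm_num)
      have h := norm_setAverage_closedBall_sub_le hp hδ0.le hloc hfin hA2
        (r := 1 / 4 * (1 / 2) ^ k) (by positivity) (by linarith) hxy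
      rw [finrank_euclideanSpace_fin] at h
      rw [pow_succ, ← mul_assoc, mul_one_div, Real.rpow_pow_comm (by norm_num)]
      refine h.trans ?_
      rw [mul_right_comm]
      gcongr
      linarith [pow_pos (one_half_pos (α := ℝ)) k])
  refine ⟨g, ?_, ?_, _, _, hsup, hhol, ?_⟩
  · filter_upwards [IsUnifLocDoublingMeasure.ae_tendsto_average volume hloc 1] with x hx
    refine tendsto_nhds_unique (hg x) (hx (fun _ => x) (fun k : ℕ => 1 / 4 * (1 / 2) ^ k) ?_ ?_)
    · refine tendsto_nhdsWithin_iff.2 ⟨?_, Eventually.of_forall fun k => ?_⟩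
      · simpa using (tendsto_pow_atTop_nhds_zero_of_lt_one (r := (1 / 2 : ℝ)) (by norm_num)
          (by norm_num)).const_mul (1 / 4 : ℝ)
      · exact Set.mem_Ioi.2 (by positivity)
    · exact Eventually.of_forall fun k => Metric.mem_closedBall_self (by positivity)
  · refine continuous_iff_continuousAt.2 fun x => tendsto_iff_norm_sub_tendsto_zero.2 ?_
    refine squeeze_zero (fun _ => norm_nonneg _) (fun y => hhol y x) ?_
    have h : Continuous fun y => ‖y - x‖ ^ δ :=
      (continuous_id.sub continuous_const).norm.rpow_const fun _ => Or.inr hδ0.le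
    simpa [hδ0.ne'] using (h.tendsto x).const_mul _
  · rw [← sub_nonneg]
    convert ha using 1
    ring
end

section
/- Let (Ω,F,P) be a probability space, V a Banach space, and (X^{(n)})_{n∈ℕ} a sequence of jointly measurable random fields X^{(n)} : Ω × ℝ^d → V. Assume that for some p ≥ 1, l ≥ 0 and β ∈ (0,1] with βp > d there is a constant N̄ > 0 such that for all x, y ∈ ℝ^d and all n: E[|X^{(n)}(x)|_V^p] ≤ N̄ r₁(x)^{lp} and E[|X^{(n)}(x) − X^{(n)}(y)|_V^p] ≤ N̄ (r₁(x)^{lp} + r₁(y)^{lp}) |x−y|^{βp}. Assume moreover that for each x ∈ ℝ^d, lim_{n→∞} E[|X^{(n)}(x)|_V^p] = 0. Then for any δ ∈ (0, β − d/p) and ε > d/p, choosing for each n a modification Y^{(n)} of x ↦ r₁(x)^{−(l+ε)} X^{(n)}(x) with sample paths in C^δ(ℝ^d;V), one has lim_{n→∞} E[ |Y^{(n)}|_{δ;V}^p ] = 0. -/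
open MeasureTheory ENNReal Filter

universe u v

/-- The weight `r₁(x) = √(1+|x|²)`. -/
noncomputable def r1 {d : ℕ} (x : EuclideanSpace ℝ (Fin d)) : ℝ :=
  Real.sqrt (1 + ‖x‖ ^ 2)

/-- The (extended-real-valued) `δ`-Hölder norm `|f|_{δ;V} = sup_x ‖f x‖ + [f]_δ`. -/
noncomputable def hNormE {E V : Type*} [NormedAddCommGroup E] [NormedAddCommGroup V]
    (δ : ℝ) (f : E → V) : ℝ≥0∞ :=
  (⨆ x, (‖f x‖₊ : ℝ≥0∞)) +
    ⨆ x, ⨆ y, ⨆ _ : x ≠ y, (‖f x - f y‖₊ : ℝ≥0∞) / (‖x - y‖₊ : ℝ≥0∞) ^ δ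

lemma EuclideanSpace.norm_le_sqrt_mul {d : ℕ} {x : EuclideanSpace ℝ (Fin d)} {c : ℝ} (hc : 0 ≤ c)
    (h : ∀ i, |x i| ≤ c) : ‖x‖ ≤ √d * c := by
  rw [EuclideanSpace.norm_eq, Real.sqrt_le_left (by positivity), mul_pow,
    Real.sq_sqrt (Nat.cast_nonneg d)]
  calc ∑ i, ‖x i‖ ^ 2 ≤ ∑ _i : Fin d, c ^ 2 := by
        gcongr with i
        exact h i
    _ = d * c ^ 2 := by simp

section Weight

variable {d : ℕ}

lemma one_le_r1 (x : EuclideanSpace ℝ (Fin d)) : 1 ≤ r1 x := by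
  rw [r1, Real.one_le_sqrt]
  nlinarith [sq_nonneg ‖x‖]

lemma r1_pos (x : EuclideanSpace ℝ (Fin d)) : 0 < r1 x :=
  zero_lt_one.trans_le (one_le_r1 x)

lemma norm_le_r1 (x : EuclideanSpace ℝ (Fin d)) : ‖x‖ ≤ r1 x :=
  Real.le_sqrt_of_sq_le (by linarith)

lemma r1_le_r1_add (x y : EuclideanSpace ℝ (Fin d)) : r1 x ≤ r1 y + ‖x - y‖ := by
  have h1 : ‖x‖ ≤ ‖y‖ + ‖x - y‖ := by
    simpa using norm_add_le y (x - y)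
  have h2 : r1 y ^ 2 = 1 + ‖y‖ ^ 2 := Real.sq_sqrt (by positivity)
  refine Real.sqrt_le_iff.2 ⟨add_nonneg (r1_pos y).le (norm_nonneg _), ?_⟩
  nlinarith [norm_le_r1 y, norm_nonneg (x - y), norm_nonneg x, norm_nonneg y,
    mul_le_mul_of_nonneg_right (norm_le_r1 y) (norm_nonneg (x - y))]

lemma r1_le_mul_r1 {x y : EuclideanSpace ℝ (Fin d)} {D : ℝ} (h : ‖x - y‖ ≤ D) :
    r1 x ≤ (1 + D) * r1 y := by
  have hD : 0 ≤ D := (norm_nonneg _).trans h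
  nlinarith [r1_le_r1_add x y, one_le_r1 y]

lemma r1_rpow_neg_le {x y : EuclideanSpace ℝ (Fin d)} {D a : ℝ} (ha : 0 ≤ a)
    (h : ‖x - y‖ ≤ D) : r1 x ^ (-a) ≤ (1 + D) ^ a * r1 y ^ (-a) := by
  have hD : 0 ≤ D := (norm_nonneg _).trans h
  have h1 : r1 y ^ a ≤ (1 + D) ^ a * r1 x ^ a := by
    rw [← Real.mul_rpow (by positivity) (r1_pos x).le]
    exact Real.rpow_le_rpow (r1_pos y).le (r1_le_mul_r1 (by rwa [norm_sub_rev])) ha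
  have hx := Real.rpow_pos_of_pos (r1_pos x) a
  have hy := Real.rpow_pos_of_pos (r1_pos y) a
  rw [Real.rpow_neg (r1_pos x).le, Real.rpow_neg (r1_pos y).le, ← div_eq_mul_inv,
    le_div_iff₀ hy, inv_mul_le_iff₀ hx]
  linarith

lemma rpow_neg_sub_rpow_neg_le {s t a : ℝ} (hs : 1 ≤ s) (hst : s ≤ t) (ha : 0 ≤ a) :
    s ^ (-a) - t ^ (-a) ≤ a * s ^ (-a) * (t - s) := by
  have hs0 : 0 < s := by linarith
  have hq : 0 < t / s := by
    have : 0 < t := by linarith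
    positivity
  have h1 : t ^ (-a) = s ^ (-a) * (t / s) ^ (-a) := by
    rw [← Real.mul_rpow hs0.le hq.le, mul_div_cancel₀ _ hs0.ne']
  have h2 : 1 - a * (t / s - 1) ≤ (t / s) ^ (-a) := by
    rw [Real.rpow_def_of_pos hq]
    nlinarith [Real.add_one_le_exp (Real.log (t / s) * -a), Real.log_le_sub_one_of_pos hq,
      mul_le_mul_of_nonneg_left (Real.log_le_sub_one_of_pos hq) ha]
  have h3 : t / s - 1 ≤ t - s := by
    rw [div_sub_one hs0.ne']
    exact div_le_self (by linarith) hs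
  have h4 : 0 < s ^ (-a) := Real.rpow_pos_of_pos hs0 _
  rw [h1]
  have h5 : 1 - (t / s) ^ (-a) ≤ a * (t - s) := by
    nlinarith [mul_le_mul_of_nonneg_left h3 ha]
  nlinarith [mul_le_mul_of_nonneg_left h5 h4.le]

lemma abs_r1_rpow_neg_sub_le {x y : EuclideanSpace ℝ (Fin d)} {D a : ℝ} (ha : 0 ≤ a)
    (h : ‖x - y‖ ≤ D) :
    |r1 x ^ (-a) - r1 y ^ (-a)| ≤ a * (1 + D) ^ a * r1 x ^ (-a) * ‖x - y‖ := by
  have hD : 0 ≤ D := (norm_nonneg _).trans h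
  have hx := Real.rpow_pos_of_pos (r1_pos x) (-a)
  have hy := Real.rpow_pos_of_pos (r1_pos y) (-a)
  rcases le_total (r1 x) (r1 y) with hxy | hxy
  · have h1 := rpow_neg_sub_rpow_neg_le (one_le_r1 x) hxy ha
    rw [abs_of_nonneg (sub_nonneg.2
      (Real.rpow_le_rpow_of_nonpos (r1_pos x) hxy (neg_nonpos.2 ha)))]
    refine h1.trans ?_
    have h2 : r1 y - r1 x ≤ ‖x - y‖ := by
      rw [norm_sub_rev]
      linarith [r1_le_r1_add y x]
    have h3 : (1 : ℝ) ≤ (1 + D) ^ a := Real.one_le_rpow (by linarith) ha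
    calc a * r1 x ^ (-a) * (r1 y - r1 x) ≤ a * r1 x ^ (-a) * ‖x - y‖ := by gcongr
      _ ≤ a * r1 x ^ (-a) * ‖x - y‖ * (1 + D) ^ a := le_mul_of_one_le_right (by positivity) h3
      _ = _ := by ring
  · have h1 := rpow_neg_sub_rpow_neg_le (one_le_r1 y) hxy ha
    rw [abs_sub_comm, abs_of_nonneg (sub_nonneg.2
      (Real.rpow_le_rpow_of_nonpos (r1_pos y) hxy (neg_nonpos.2 ha)))]
    refine h1.trans ?_
    have h2 : r1 x - r1 y ≤ ‖x - y‖ := by linarith [r1_le_r1_add x y]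
    have h3 : r1 y ^ (-a) ≤ (1 + D) ^ a * r1 x ^ (-a) :=
      r1_rpow_neg_le ha (by rwa [norm_sub_rev])
    calc a * r1 y ^ (-a) * (r1 x - r1 y)
        ≤ a * ((1 + D) ^ a * r1 x ^ (-a)) * ‖x - y‖ := by gcongr
      _ = _ := by ring

end Weight

/-- The point of the dyadic grid `2⁻ᵏℤᵈ` with index `m`. -/
noncomputable def dyadicPoint {d : ℕ} (k : ℕ) (m : Fin d → ℤ) : EuclideanSpace ℝ (Fin d) :=
  WithLp.toLp 2 fun i => (m i : ℝ) / 2 ^ k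

@[simp]
lemma dyadicPoint_apply {d : ℕ} (k : ℕ) (m : Fin d → ℤ) (i : Fin d) :
    dyadicPoint k m i = (m i : ℝ) / 2 ^ k := rfl

section LatticeSum

variable {d : ℕ}

lemma tsum_r1_intPoint_rpow_ne_top {a : ℝ} (ha : (d : ℝ) < a) :
    ∑' q : Fin d → ℤ, ENNReal.ofReal (r1 (dyadicPoint 0 q) ^ (-a)) ≠ ⊤ := by
  classical
  set b := (EuclideanSpace.basisFun (Fin d) ℝ).toBasis with hb
  let L : Submodule ℤ (EuclideanSpace ℝ (Fin d)) := Submodule.span ℤ (Set.range b)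
  have hmem : ∀ q : Fin d → ℤ, dyadicPoint 0 q ∈ L := by
    intro q
    refine (b.mem_span_iff_repr_mem ℤ _).2 fun i => ⟨q i, ?_⟩
    simp [hb]
  have hrank : Module.finrank ℤ L = d := by
    rw [ZLattice.rank ℝ L]
    simp
  have hsum : Summable fun z : L => ‖z‖ ^ (-a) :=
    ZLattice.summable_norm_rpow L (-a) (by rw [hrank]; linarith)
  have hinj : Function.Injective fun q : Fin d → ℤ => (⟨dyadicPoint 0 q, hmem q⟩ : L) := by
    intro q q' h
    funext i
    have := congrArg (fun z : L => (z : EuclideanSpace ℝ (Fin d)) i) h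
    simpa using this
  have hsum' := hsum.comp_injective hinj
  have hsum0 : Summable fun q : Fin d → ℤ => if q = 0 then (1 : ℝ) else 0 :=
    (hasSum_ite_eq (0 : Fin d → ℤ) (1 : ℝ)).summable
  have hS : Summable fun q : Fin d → ℤ => r1 (dyadicPoint 0 q) ^ (-a) := by
    refine Summable.of_nonneg_of_le (fun q => Real.rpow_nonneg (r1_pos _).le _) (fun q => ?_)
      (hsum'.add hsum0)
    have ha0 : -a ≤ 0 := by
      have : (0 : ℝ) ≤ d := Nat.cast_nonneg d
      linarith
    by_cases hq : q = 0
    · subst hq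
      have h1 : r1 (dyadicPoint 0 (0 : Fin d → ℤ)) ^ (-a) ≤ 1 :=
        Real.rpow_le_one_of_one_le_of_nonpos (one_le_r1 _) ha0
      have h2 : 0 ≤ ‖(⟨dyadicPoint 0 (0 : Fin d → ℤ), hmem 0⟩ : L)‖ ^ (-a) := by positivity
      simpa using h1.trans (le_add_of_nonneg_left h2)
    · have h0 : dyadicPoint 0 q ≠ 0 := by
        intro h
        apply hq
        funext i
        have := congrArg (fun z : EuclideanSpace ℝ (Fin d) => z i) h
        simpa using this
      simpa [hq] using Real.rpow_le_rpow_of_nonpos (norm_pos_iff.2 h0) (norm_le_r1 _) ha0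
  exact hS.tsum_ofReal_ne_top

lemma tsum_r1_dyadicPoint_rpow_le {a : ℝ} (ha : (d : ℝ) < a) :
    ∃ C : ℝ≥0∞, C ≠ ⊤ ∧ ∀ k : ℕ,
      ∑' m : Fin d → ℤ, ENNReal.ofReal (r1 (dyadicPoint k m) ^ (-a)) ≤ C * (2 ^ k) ^ d := by
  have ha0 : 0 ≤ a := (Nat.cast_nonneg d).trans ha.le
  refine ⟨ENNReal.ofReal ((1 + √d) ^ a) *
    ∑' q : Fin d → ℤ, ENNReal.ofReal (r1 (dyadicPoint 0 q) ^ (-a)),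
    ENNReal.mul_ne_top ENNReal.ofReal_ne_top (tsum_r1_intPoint_rpow_ne_top ha), fun k => ?_⟩
  let e : (Fin d → ℤ) ≃ (Fin d → ℤ) × (Fin d → Fin (2 ^ k)) :=
    (Equiv.arrowCongr (Equiv.refl _) (Int.divModEquiv (2 ^ k))).trans
      (Equiv.arrowProdEquivProdArrow _ _ _)
  have he : ∀ q s i, e.symm (q, s) i = q i * 2 ^ k + ((s i : ℕ) : ℤ) := by
    intro q s i
    simp [e, Equiv.arrowProdEquivProdArrow, Equiv.arrowCongr]
  have hterm : ∀ q s, ENNReal.ofReal (r1 (dyadicPoint k (e.symm (q, s))) ^ (-a)) ≤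
      ENNReal.ofReal ((1 + √d) ^ a) * ENNReal.ofReal (r1 (dyadicPoint 0 q) ^ (-a)) := by
    intro q s
    rw [← ENNReal.ofReal_mul (by positivity)]
    refine ENNReal.ofReal_le_ofReal (r1_rpow_neg_le ha0 ?_)
    refine (EuclideanSpace.norm_le_sqrt_mul zero_le_one fun i => ?_).trans_eq (mul_one _)
    have h2 : (0 : ℝ) < 2 ^ k := by positivity
    have h3 : ((s i : ℕ) : ℝ) ≤ 2 ^ k := by exact_mod_cast (s i).is_lt.le
    have h4 : (dyadicPoint k (e.symm (q, s)) - dyadicPoint 0 q) i = ((s i : ℕ) : ℝ) / 2 ^ k := by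
      rw [PiLp.sub_apply, dyadicPoint_apply, dyadicPoint_apply, he]
      push_cast
      field_simp
      ring
    rw [h4, abs_of_nonneg (by positivity)]
    exact div_le_one_of_le₀ h3 h2.le
  calc ∑' m : Fin d → ℤ, ENNReal.ofReal (r1 (dyadicPoint k m) ^ (-a))
      = ∑' z : (Fin d → ℤ) × (Fin d → Fin (2 ^ k)),
          ENNReal.ofReal (r1 (dyadicPoint k (e.symm z)) ^ (-a)) :=
        (e.symm.tsum_eq fun m => ENNReal.ofReal (r1 (dyadicPoint k m) ^ (-a))).symm
    _ = ∑' (q : Fin d → ℤ) (s : Fin d → Fin (2 ^ k)),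
          ENNReal.ofReal (r1 (dyadicPoint k (e.symm (q, s))) ^ (-a)) :=
        ENNReal.tsum_prod'
    _ ≤ ∑' (q : Fin d → ℤ) (_s : Fin d → Fin (2 ^ k)),
          ENNReal.ofReal ((1 + √d) ^ a) * ENNReal.ofReal (r1 (dyadicPoint 0 q) ^ (-a)) :=
        ENNReal.tsum_le_tsum fun q => ENNReal.tsum_le_tsum fun s => hterm q s
    _ = _ := by
        simp only [tsum_fintype, Finset.sum_const, nsmul_eq_mul, Finset.card_univ,
          Fintype.card_fun, Fintype.card_fin, ENNReal.tsum_mul_left]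
        push_cast
        ring

end LatticeSum

section Chaining

variable {d : ℕ} {V : Type*} [NormedAddCommGroup V]

/-- The index of the corner of the level `k` dyadic cube that contains `x`. -/
noncomputable def dyadicFloor (k : ℕ) (x : EuclideanSpace ℝ (Fin d)) : Fin d → ℤ :=
  fun i => ⌊x i * 2 ^ k⌋

lemma norm_sub_dyadicPoint_dyadicFloor_le (k : ℕ) (x : EuclideanSpace ℝ (Fin d)) :
    ‖dyadicPoint k (dyadicFloor k x) - x‖ ≤ √d * (1 / 2) ^ k := by
  refine EuclideanSpace.norm_le_sqrt_mul (by positivity) fun i => ?_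
  have h2 : (0 : ℝ) < 2 ^ k := by positivity
  have h3 : (dyadicPoint k (dyadicFloor k x) - x) i = (⌊x i * 2 ^ k⌋ - x i * 2 ^ k) / 2 ^ k := by
    rw [PiLp.sub_apply, dyadicPoint_apply, dyadicFloor]
    field_simp
  rw [h3, abs_div, abs_of_pos h2, one_div, inv_pow, ← one_div]
  gcongr
  rw [abs_le]
  constructor <;> linarith [Int.floor_le (x i * 2 ^ k), Int.lt_floor_add_one (x i * 2 ^ k)]

lemma tendsto_dyadicPoint_dyadicFloor (x : EuclideanSpace ℝ (Fin d)) :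
    Tendsto (fun k => dyadicPoint k (dyadicFloor k x)) atTop (nhds x) := by
  rw [tendsto_iff_norm_sub_tendsto_zero]
  refine squeeze_zero (fun _ => norm_nonneg _)
    (fun k => norm_sub_dyadicPoint_dyadicFloor_le k x) ?_
  simpa using (tendsto_pow_atTop_nhds_zero_of_lt_one (r := (1 / 2 : ℝ)) (by norm_num)
    (by norm_num)).const_mul √d

lemma dyadicPoint_succ_two_mul (k : ℕ) (m : Fin d → ℤ) :
    dyadicPoint (k + 1) (fun i => 2 * m i) = dyadicPoint k m := by
  ext i
  simp only [dyadicPoint_apply, pow_succ]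
  push_cast
  field_simp

lemma abs_two_mul_dyadicFloor_sub_le (k : ℕ) (x : EuclideanSpace ℝ (Fin d)) (i : Fin d) :
    |2 * dyadicFloor k x i - dyadicFloor (k + 1) x i| ≤ 1 := by
  have h1 := Int.floor_le (x i * 2 ^ k)
  have h2 := Int.lt_floor_add_one (x i * 2 ^ k)
  have h3 := Int.floor_le (x i * 2 ^ (k + 1))
  have h4 := Int.lt_floor_add_one (x i * 2 ^ (k + 1))
  rw [pow_succ, ← mul_assoc] at h3 h4
  simp only [dyadicFloor, pow_succ, ← mul_assoc]
  have h5 : 2 * ⌊x i * 2 ^ k⌋ < ⌊x i * 2 ^ k * 2⌋ + 1 := by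
    exact_mod_cast (show (2 * ⌊x i * 2 ^ k⌋ : ℝ) < ⌊x i * 2 ^ k * 2⌋ + 1 by linarith)
  have h6 : ⌊x i * 2 ^ k * 2⌋ < 2 * ⌊x i * 2 ^ k⌋ + 2 := by
    exact_mod_cast (show (⌊x i * 2 ^ k * 2⌋ : ℝ) < 2 * ⌊x i * 2 ^ k⌋ + 2 by linarith)
  rw [abs_le]
  omega

lemma abs_dyadicFloor_sub_le {k : ℕ} {x y : EuclideanSpace ℝ (Fin d)}
    (h : ‖x - y‖ ≤ (1 / 2) ^ k) (i : Fin d) :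
    |dyadicFloor k x i - dyadicFloor k y i| ≤ 1 := by
  have hi : |x i - y i| ≤ (1 / 2) ^ k := by
    simpa using (PiLp.norm_apply_le (x - y) i).trans h
  have h0 : |x i * 2 ^ k - y i * 2 ^ k| ≤ 1 := by
    rw [← sub_mul, abs_mul, abs_of_pos (by positivity : (0 : ℝ) < 2 ^ k)]
    calc |x i - y i| * 2 ^ k ≤ (1 / 2) ^ k * 2 ^ k := by gcongr
      _ = 1 := by rw [← mul_pow]; norm_num
  obtain ⟨h0l, h0r⟩ := abs_le.1 h0
  have h1 := Int.floor_le (x i * 2 ^ k)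
  have h2 := Int.lt_floor_add_one (x i * 2 ^ k)
  have h3 := Int.floor_le (y i * 2 ^ k)
  have h4 := Int.lt_floor_add_one (y i * 2 ^ k)
  have h5 : ⌊x i * 2 ^ k⌋ < ⌊y i * 2 ^ k⌋ + 2 := by
    exact_mod_cast (show (⌊x i * 2 ^ k⌋ : ℝ) < ⌊y i * 2 ^ k⌋ + 2 by linarith)
  have h6 : ⌊y i * 2 ^ k⌋ < ⌊x i * 2 ^ k⌋ + 2 := by
    exact_mod_cast (show (⌊y i * 2 ^ k⌋ : ℝ) < ⌊x i * 2 ^ k⌋ + 2 by linarith)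
  simp only [dyadicFloor]
  rw [abs_le]
  omega

lemma hNormE_le_of_forall_le {δ C : ℝ} {f : EuclideanSpace ℝ (Fin d) → V} {A B : ℝ}
    (hC : A + B ≤ C) (hA : 0 ≤ A) (hB : 0 ≤ B) (hsup : ∀ x, ‖f x‖ ≤ A)
    (hhol : ∀ x y, x ≠ y → ‖f x - f y‖ ≤ B * ‖x - y‖ ^ δ) :
    hNormE δ f ≤ ENNReal.ofReal C := by
  refine le_trans ?_ (ENNReal.ofReal_le_ofReal hC)
  rw [ENNReal.ofReal_add hA hB, hNormE]
  refine add_le_add (iSup_le fun x => ?_)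
    (iSup_le fun x => iSup_le fun y => iSup_le fun hxy => ?_)
  · rw [← enorm_eq_nnnorm, ← ofReal_norm]
    exact ENNReal.ofReal_le_ofReal (hsup x)
  · have hpos : 0 < ‖x - y‖ := norm_pos_iff.2 (sub_ne_zero.2 hxy)
    rw [← enorm_eq_nnnorm, ← ofReal_norm, ← enorm_eq_nnnorm, ← ofReal_norm,
      ENNReal.ofReal_rpow_of_pos hpos, ← ENNReal.ofReal_div_of_pos (Real.rpow_pos_of_pos hpos _)]
    refine ENNReal.ofReal_le_ofReal ?_
    rw [div_le_iff₀ (Real.rpow_pos_of_pos hpos _)]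
    exact hhol x y hxy

/-- Chaining: a continuous function is Hölder as soon as its increments between neighbouring
dyadic points are, with a quantitative bound. -/
lemma exists_hNormE_le_of_dyadic {δ : ℝ} (hδ : 0 < δ) :
    ∃ C : ℝ, 0 < C ∧ ∀ (f : EuclideanSpace ℝ (Fin d) → V), Continuous f → ∀ M : ℝ, 0 ≤ M →
      (∀ m, ‖f (dyadicPoint 0 m)‖ ≤ M) →
      (∀ k m m', (∀ i, |m i - m' i| ≤ 1) →
        ‖f (dyadicPoint k m) - f (dyadicPoint k m')‖ ≤ M * (2 ^ (-δ)) ^ k) →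
      hNormE δ f ≤ ENNReal.ofReal (C * M) := by
  set q : ℝ := 2 ^ (-δ) with hq
  have hq0 : 0 < q := Real.rpow_pos_of_pos two_pos _
  have hq1 : q < 1 := Real.rpow_lt_one_of_one_lt_of_neg one_lt_two (neg_lt_zero.2 hδ)
  have hq2 : q = (1 / 2) ^ δ := by
    rw [hq, Real.rpow_neg two_pos.le, one_div, Real.inv_rpow two_pos.le]
  set B : ℝ := 1 / (1 - q) with hB
  have hB0 : 0 < B := one_div_pos.2 (by linarith)
  refine ⟨(1 + B) + 2 * (1 + B) / q, by positivity, fun f hf M hM hM0 hMk => ?_⟩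
  have htail : ∀ k x, ‖f (dyadicPoint k (dyadicFloor k x)) - f x‖ ≤ M * B * q ^ k := by
    intro k x
    have h1 : ∀ n, dist (f (dyadicPoint n (dyadicFloor n x)))
        (f (dyadicPoint (n + 1) (dyadicFloor (n + 1) x))) ≤ M * q ^ n := by
      intro n
      rw [dist_eq_norm, ← dyadicPoint_succ_two_mul n]
      refine (hMk (n + 1) _ _ (abs_two_mul_dyadicFloor_sub_le n x)).trans ?_
      gcongr M * ?_
      exact pow_le_pow_of_le_one hq0.le hq1.le n.le_succ
    have h2 := dist_le_of_le_geometric_of_tendsto q M hq1 h1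
      ((hf.tendsto x).comp (tendsto_dyadicPoint_dyadicFloor x)) k
    rw [dist_eq_norm] at h2
    refine h2.trans_eq ?_
    rw [hB]
    ring
  have hsup : ∀ x, ‖f x‖ ≤ (1 + B) * M := by
    intro x
    have h1 := htail 0 x
    rw [norm_sub_rev, pow_zero, mul_one] at h1
    have h2 := norm_le_norm_add_norm_sub' (f x) (f (dyadicPoint 0 (dyadicFloor 0 x)))
    linarith [hM0 (dyadicFloor 0 x)]
  refine hNormE_le_of_forall_le (A := (1 + B) * M) (B := 2 * (1 + B) / q * M) (by linarith)
    (by positivity) (by positivity) hsup fun x y hxy => ?_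
  have hpos : 0 < ‖x - y‖ := norm_pos_iff.2 (sub_ne_zero.2 hxy)
  rcases le_total ‖x - y‖ 1 with h1 | h1
  · obtain ⟨k, hk1, hk2⟩ := exists_nat_pow_near_of_lt_one hpos h1
      (by norm_num : (0 : ℝ) < 1 / 2) (by norm_num)
    have h3 := hMk k _ _ (abs_dyadicFloor_sub_le hk2)
    have h4 := htail k x
    have h5 := htail k y
    rw [norm_sub_rev] at h4
    have h6 : ‖f x - f y‖ ≤ M * B * q ^ k + M * q ^ k + M * B * q ^ k := by
      calc ‖f x - f y‖ = ‖(f x - f (dyadicPoint k (dyadicFloor k x))) +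
            (f (dyadicPoint k (dyadicFloor k x)) - f (dyadicPoint k (dyadicFloor k y))) +
            (f (dyadicPoint k (dyadicFloor k y)) - f y)‖ := by congr 1; abel
        _ ≤ _ := norm_add₃_le.trans (by gcongr)
    have h7 : q ^ (k + 1) ≤ ‖x - y‖ ^ δ := by
      rw [hq2, ← Real.rpow_mul_natCast (by norm_num), mul_comm, Real.rpow_natCast_mul (by norm_num)]
      exact Real.rpow_le_rpow (by positivity) hk1.le hδ.le
    calc ‖f x - f y‖ ≤ 2 * (1 + B) * M * q ^ k := by
          nlinarith [mul_nonneg hM (pow_pos hq0 k).le]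
      _ = 2 * (1 + B) / q * M * q ^ (k + 1) := by
          rw [pow_succ]
          field_simp
      _ ≤ _ := by gcongr
  · calc ‖f x - f y‖ ≤ ‖f x‖ + ‖f y‖ := norm_sub_le _ _
      _ ≤ 2 * (1 + B) * M := by linarith [hsup x, hsup y]
      _ ≤ 2 * (1 + B) / q * M := by
          gcongr
          exact le_div_self (by positivity) hq0 hq1.le
      _ ≤ _ := le_mul_of_one_le_right (by positivity) (Real.one_le_rpow h1 hδ.le)

/-- The `ℓᵖ` sum of the values on the integer grid and of the weighted dyadic increments controls
the `p`-th power of the Hölder norm. -/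
lemma exists_hNormE_rpow_le_tsum {δ p : ℝ} (hδ : 0 < δ) (hp : 0 < p) :
    ∃ C : ℝ≥0∞, C ≠ ⊤ ∧ ∀ (f : EuclideanSpace ℝ (Fin d) → V), Continuous f →
      hNormE δ f ^ p ≤ C * (∑' m : Fin d → ℤ, ‖f (dyadicPoint 0 m)‖ₑ ^ p +
        ∑' z : ℕ × (Fin d → ℤ) × (Fin d → SignType), ENNReal.ofReal ((2 ^ (δ * p)) ^ z.1) *
          ‖f (dyadicPoint z.1 z.2.1) - f (dyadicPoint z.1 (z.2.1 + fun i => (z.2.2 i : ℤ)))‖ₑ ^ p)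
      := by
  obtain ⟨C, hC, h⟩ := exists_hNormE_le_of_dyadic (d := d) (V := V) hδ
  refine ⟨ENNReal.ofReal C ^ p, ENNReal.rpow_ne_top_of_nonneg hp.le ENNReal.ofReal_ne_top,
    fun f hf => ?_⟩
  set S := ∑' m : Fin d → ℤ, ‖f (dyadicPoint 0 m)‖ₑ ^ p
  set T := ∑' z : ℕ × (Fin d → ℤ) × (Fin d → SignType), ENNReal.ofReal ((2 ^ (δ * p)) ^ z.1) *
    ‖f (dyadicPoint z.1 z.2.1) - f (dyadicPoint z.1 (z.2.1 + fun i => (z.2.2 i : ℤ)))‖ₑ ^ p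
  by_cases htop : S + T = ⊤
  · rw [htop, ENNReal.mul_top]
    · exact le_top
    · simp [hC]
  have hroot : ∀ (v : V) (c : ℝ), 0 < c → ENNReal.ofReal (c ^ p) * ‖v‖ₑ ^ p ≤ S + T →
      ‖v‖ ≤ (S + T).toReal ^ (1 / p) * c⁻¹ := by
    intro v c hc hv
    rw [← ENNReal.ofReal_rpow_of_pos hc, ← ENNReal.mul_rpow_of_nonneg _ _ hp.le,
      ← ofReal_norm, ← ENNReal.ofReal_mul hc.le,
      ENNReal.ofReal_rpow_of_nonneg (by positivity) hp.le] at hv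
    have h1 := (ENNReal.ofReal_le_iff_le_toReal htop).1 hv
    rw [← div_eq_mul_inv, le_div_iff₀ hc, mul_comm]
    rw [one_div]
    exact (Real.le_rpow_inv_iff_of_pos (by positivity) ENNReal.toReal_nonneg hp).2 h1
  have hM := h f hf ((S + T).toReal ^ (1 / p)) (by positivity) (fun m => ?_) fun k m m' hm => ?_
  · calc hNormE δ f ^ p ≤ ENNReal.ofReal (C * (S + T).toReal ^ (1 / p)) ^ p := by gcongr
      _ = ENNReal.ofReal C ^ p * (S + T) := by
        rw [ENNReal.ofReal_mul hC.le, ENNReal.mul_rpow_of_nonneg _ _ hp.le,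
          ENNReal.ofReal_rpow_of_nonneg
            (show 0 ≤ (S + T).toReal ^ (1 / p) by positivity) hp.le,
          ← Real.rpow_mul ENNReal.toReal_nonneg, one_div_mul_cancel hp.ne', Real.rpow_one,
          ENNReal.ofReal_toReal htop]
  · have := hroot (f (dyadicPoint 0 m)) 1 one_pos (by
      simpa using (ENNReal.le_tsum (f := fun m => ‖f (dyadicPoint 0 m)‖ₑ ^ p) m).trans
        le_self_add)
    simpa using this
  · have hm' : m' = m + fun i => ((SignType.sign (m' i - m i) : SignType) : ℤ) := by
      funext i
      have h1 := abs_le.1 (hm i)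
      have h2 : m' i - m i = -1 ∨ m' i - m i = 0 ∨ m' i - m i = 1 := by omega
      have h3 : ((SignType.sign (m' i - m i) : SignType) : ℤ) = m' i - m i := by
        rcases h2 with h2 | h2 | h2 <;> rw [h2] <;> rfl
      rw [Pi.add_apply, h3]
      ring
    have h4 : (2 : ℝ) ^ (-δ) = (2 ^ δ)⁻¹ := Real.rpow_neg two_pos.le _
    rw [h4, inv_pow]
    refine hroot _ _ (by positivity) ?_
    have h5 : (((2 : ℝ) ^ δ) ^ k) ^ p = (2 ^ (δ * p)) ^ k := by
      rw [Real.rpow_mul two_pos.le]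
      exact (Real.rpow_pow_comm (by positivity) p k).symm
    rw [h5]
    refine le_trans ?_ (le_add_self (a := T))
    have h6 := ENNReal.le_tsum (f := fun z : ℕ × (Fin d → ℤ) × (Fin d → SignType) =>
      ENNReal.ofReal ((2 ^ (δ * p)) ^ z.1) * ‖f (dyadicPoint z.1 z.2.1) -
        f (dyadicPoint z.1 (z.2.1 + fun i => (z.2.2 i : ℤ)))‖ₑ ^ p)
      (k, m, fun i => SignType.sign (m' i - m i))
    simp only [← hm'] at h6
    exact h6

end Chaining

section Moments

variable {Ω V : Type*} [MeasurableSpace Ω] {P : Measure Ω} [NormedAddCommGroup V] [NormedSpace ℝ V]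

lemma lintegral_enorm_smul_add_smul_rpow_le {p : ℝ} (hp : 1 ≤ p) {F G : Ω → V}
    (hF : AEStronglyMeasurable F P) (s t : ℝ) :
    ∫⁻ ω, ‖s • F ω + t • G ω‖ₑ ^ p ∂P ≤
      2 ^ (p - 1) * (‖s‖ₑ ^ p * ∫⁻ ω, ‖F ω‖ₑ ^ p ∂P + ‖t‖ₑ ^ p * ∫⁻ ω, ‖G ω‖ₑ ^ p ∂P) := by
  have hp0 : 0 ≤ p := zero_le_one.trans hp
  have hfin : ∀ c : ℝ, ‖c‖ₑ ^ p ≠ ⊤ := fun c => ENNReal.rpow_ne_top_of_nonneg hp0 enorm_ne_top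
  calc ∫⁻ ω, ‖s • F ω + t • G ω‖ₑ ^ p ∂P
      ≤ ∫⁻ ω, 2 ^ (p - 1) * (‖s‖ₑ ^ p * ‖F ω‖ₑ ^ p + ‖t‖ₑ ^ p * ‖G ω‖ₑ ^ p) ∂P := by
        refine lintegral_mono fun ω => ?_
        calc ‖s • F ω + t • G ω‖ₑ ^ p ≤ (‖s • F ω‖ₑ + ‖t • G ω‖ₑ) ^ p := by
              gcongr
              exact enorm_add_le _ _
          _ ≤ 2 ^ (p - 1) * (‖s • F ω‖ₑ ^ p + ‖t • G ω‖ₑ ^ p) :=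
              ENNReal.rpow_add_le_mul_rpow_add_rpow _ _ hp
          _ = _ := by
              rw [enorm_smul, enorm_smul, ENNReal.mul_rpow_of_nonneg _ _ hp0,
                ENNReal.mul_rpow_of_nonneg _ _ hp0]
    _ = _ := by
        rw [lintegral_const_mul' _ _
            (ENNReal.rpow_ne_top_of_nonneg (sub_nonneg.2 hp) ENNReal.ofNat_ne_top),
          lintegral_add_left' ((hF.enorm.pow_const p).const_mul _),
          lintegral_const_mul' _ _ (hfin s), lintegral_const_mul' _ _ (hfin t)]

variable {d : ℕ}

lemma r1_rpow_neg_add_rpow_mul (x : EuclideanSpace ℝ (Fin d)) (l ε p : ℝ) :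
    (r1 x ^ (-(l + ε))) ^ p * r1 x ^ (l * p) = r1 x ^ (-(ε * p)) := by
  rw [← Real.rpow_mul (r1_pos x).le, ← Real.rpow_add (r1_pos x)]
  congr 1
  ring

lemma lintegral_enorm_weighted_sub_rpow_le {p l ε β N D : ℝ} (hp : 1 ≤ p) (hl : 0 ≤ l)
    (hε : 0 ≤ ε) (hβ : β ∈ Set.Ioc (0 : ℝ) 1) (hN : 0 ≤ N) (hD : 1 ≤ D) {A B : Ω → V}
    (hA : AEStronglyMeasurable A P) (hB : AEStronglyMeasurable B P)
    {x y : EuclideanSpace ℝ (Fin d)} (hxy : ‖x - y‖ ≤ D)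
    (hBmom : ∫⁻ ω, ‖B ω‖ₑ ^ p ∂P ≤ ENNReal.ofReal (N * r1 y ^ (l * p)))
    (hAB : ∫⁻ ω, ‖A ω - B ω‖ₑ ^ p ∂P ≤
      ENNReal.ofReal (N * (r1 x ^ (l * p) + r1 y ^ (l * p)) * ‖x - y‖ ^ (β * p))) :
    ∫⁻ ω, ‖r1 x ^ (-(l + ε)) • A ω - r1 y ^ (-(l + ε)) • B ω‖ₑ ^ p ∂P ≤
      ENNReal.ofReal (2 ^ (p - 1) * N * (1 + (1 + D) ^ (l * p) +
        ((l + ε) * (1 + D) ^ (l + ε) * D) ^ p * (1 + D) ^ (l * p)) *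
        r1 x ^ (-(ε * p)) * ‖x - y‖ ^ (β * p)) := by
  have hp0 : 0 ≤ p := zero_le_one.trans hp
  set s := r1 x ^ (-(l + ε)) with hs
  set t := r1 y ^ (-(l + ε))
  set G := (1 + D) ^ (l * p) with hG
  set H := (l + ε) * (1 + D) ^ (l + ε) * D with hH
  set τ := ‖x - y‖ with hτ
  have hτ0 : 0 ≤ τ := norm_nonneg _
  have hs0 : 0 ≤ s := Real.rpow_nonneg (r1_pos x).le _
  have hG0 : 0 ≤ G := by positivity
  have hH0 : 0 ≤ H := by positivity
  have hRx : 0 ≤ r1 x ^ (l * p) := Real.rpow_nonneg (r1_pos x).le _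
  have hRy : 0 ≤ r1 y ^ (l * p) := Real.rpow_nonneg (r1_pos y).le _
  have hτβ : τ ≤ D * τ ^ β := by
    rcases hτ0.eq_or_lt with h | h
    · rw [← h]
      positivity
    · calc τ = τ ^ (1 - β) * τ ^ β := by rw [← Real.rpow_add h]; simp
        _ ≤ D ^ (1 - β) * τ ^ β := by
            gcongr
            linarith [hβ.2]
        _ ≤ D ^ (1 : ℝ) * τ ^ β := by
            gcongr
            linarith [hβ.1]
        _ = D * τ ^ β := by rw [Real.rpow_one]
  have hst : |s - t| ≤ H * s * τ ^ β := by
    refine (abs_r1_rpow_neg_sub_le (by positivity : 0 ≤ l + ε) hxy).trans ?_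
    calc (l + ε) * (1 + D) ^ (l + ε) * s * τ
        ≤ (l + ε) * (1 + D) ^ (l + ε) * s * (D * τ ^ β) := by gcongr
      _ = H * s * τ ^ β := by rw [hH]; ring
  have hyx : r1 y ^ (l * p) ≤ G * r1 x ^ (l * p) := by
    rw [hG, ← Real.mul_rpow (by positivity) (r1_pos x).le]
    exact Real.rpow_le_rpow (r1_pos y).le (r1_le_mul_r1 (by rwa [norm_sub_rev])) (by positivity)
  have hs_e : ‖s‖ₑ ^ p = ENNReal.ofReal (s ^ p) := by
    rw [← ofReal_norm, Real.norm_of_nonneg hs0, ENNReal.ofReal_rpow_of_nonneg hs0 hp0]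
  have hst_e : ‖s - t‖ₑ ^ p ≤ ENNReal.ofReal ((H * s) ^ p * τ ^ (β * p)) := by
    rw [← ofReal_norm, ENNReal.ofReal_rpow_of_nonneg (norm_nonneg _) hp0]
    refine ENNReal.ofReal_le_ofReal ?_
    rw [Real.rpow_mul hτ0, ← Real.mul_rpow (by positivity) (by positivity)]
    exact Real.rpow_le_rpow (norm_nonneg _) hst hp0
  have h2 : (2 : ℝ≥0∞) ^ (p - 1) = ENNReal.ofReal (2 ^ (p - 1)) := by
    rw [← ENNReal.ofReal_rpow_of_pos two_pos]
    simp
  have hdecomp : ∀ ω, s • A ω - t • B ω = s • (A ω - B ω) + (s - t) • B ω := fun ω => by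
    rw [smul_sub, sub_smul]
    abel
  simp_rw [hdecomp]
  refine (lintegral_enorm_smul_add_smul_rpow_le hp (hA.sub hB) s (s - t)).trans ?_
  calc 2 ^ (p - 1) * (‖s‖ₑ ^ p * ∫⁻ ω, ‖A ω - B ω‖ₑ ^ p ∂P
        + ‖s - t‖ₑ ^ p * ∫⁻ ω, ‖B ω‖ₑ ^ p ∂P)
      ≤ ENNReal.ofReal (2 ^ (p - 1)) * (ENNReal.ofReal (s ^ p) *
          ENNReal.ofReal (N * (r1 x ^ (l * p) + r1 y ^ (l * p)) * τ ^ (β * p)) +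
          ENNReal.ofReal ((H * s) ^ p * τ ^ (β * p)) *
          ENNReal.ofReal (N * r1 y ^ (l * p))) := by
        rw [h2, hs_e]
        gcongr
    _ = ENNReal.ofReal (2 ^ (p - 1) * (s ^ p *
          (N * (r1 x ^ (l * p) + r1 y ^ (l * p)) * τ ^ (β * p)) +
          (H * s) ^ p * τ ^ (β * p) * (N * r1 y ^ (l * p)))) := by
        rw [← ENNReal.ofReal_mul (by positivity), ← ENNReal.ofReal_mul (by positivity),
          ← ENNReal.ofReal_add (by positivity) (by positivity),
          ← ENNReal.ofReal_mul (by positivity)]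
    _ ≤ ENNReal.ofReal (2 ^ (p - 1) * (s ^ p *
          (N * (r1 x ^ (l * p) + G * r1 x ^ (l * p)) * τ ^ (β * p)) +
          (H * s) ^ p * τ ^ (β * p) * (N * (G * r1 x ^ (l * p))))) := by
        gcongr
    _ = _ := by
        rw [Real.mul_rpow hH0 hs0, ← r1_rpow_neg_add_rpow_mul x l ε p, ← hs]
        congr 1
        ring

end Moments

lemma ENNReal.tendsto_tsum_of_dominated {ι : Type*} [Countable ι] {F : ℕ → ι → ℝ≥0∞}
    {bound : ι → ℝ≥0∞} (hbound : ∀ n i, F n i ≤ bound i) (hfin : ∑' i, bound i ≠ ⊤)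
    (hlim : ∀ i, Tendsto (fun n => F n i) atTop (nhds 0)) :
    Tendsto (fun n => ∑' i, F n i) atTop (nhds 0) := by
  let _ : MeasurableSpace ι := ⊤
  have _ : MeasurableSingletonClass ι := ⟨fun _ => trivial⟩
  have h := tendsto_lintegral_of_dominated_convergence (μ := Measure.count) (F := F)
    (f := fun _ => 0) bound (fun n => measurable_from_top)
    (fun n => Eventually.of_forall (hbound n)) (by rwa [lintegral_count])
    (Eventually.of_forall hlim)
  simpa [lintegral_count] using h

section DyadicBounds

variable {d : ℕ}

lemma norm_dyadicPoint_sub_add_le (k : ℕ) (m : Fin d → ℤ) (e : Fin d → SignType) :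
    ‖dyadicPoint k m - dyadicPoint k (m + fun i => (e i : ℤ))‖ ≤ √d * (1 / 2) ^ k := by
  refine EuclideanSpace.norm_le_sqrt_mul (by positivity) fun i => ?_
  have h1 : (dyadicPoint k m - dyadicPoint k (m + fun i => (e i : ℤ))) i =
      -((e i : ℤ) : ℝ) * (1 / 2) ^ k := by
    simp only [PiLp.sub_apply, dyadicPoint_apply, Pi.add_apply]
    push_cast
    rw [one_div, inv_pow]
    ring
  rw [h1, abs_mul, abs_of_pos (by positivity : (0 : ℝ) < (1 / 2) ^ k)]
  refine mul_le_of_le_one_left (by positivity) ?_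
  rcases e i with _ | _ | _ <;> norm_num

lemma tsum_dyadic_increment_bound_ne_top {δ β p a K : ℝ} (hp : 0 < p) (ha : (d : ℝ) < a)
    (hδ : δ < β - d / p) :
    ∑' z : ℕ × (Fin d → ℤ) × (Fin d → SignType), ENNReal.ofReal ((2 ^ (δ * p)) ^ z.1) *
      ENNReal.ofReal (K * r1 (dyadicPoint z.1 z.2.1) ^ (-a) * (√d * (1 / 2) ^ z.1) ^ (β * p))
        ≠ ⊤ := by
  obtain ⟨C, hC, hsum⟩ := tsum_r1_dyadicPoint_rpow_le ha
  set ρ : ℝ := 2 ^ (δ * p) * (1 / 2) ^ (β * p) with hρ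
  set c := ENNReal.ofReal (√d ^ (β * p)) * ENNReal.ofReal K with hc
  have hρ0 : 0 ≤ ρ := by positivity
  have hterm : ∀ k m, ENNReal.ofReal ((2 ^ (δ * p)) ^ k) *
      ENNReal.ofReal (K * r1 (dyadicPoint k m) ^ (-a) * (√d * (1 / 2) ^ k) ^ (β * p)) =
      c * ENNReal.ofReal (ρ ^ k) * ENNReal.ofReal (r1 (d := d) (dyadicPoint k m) ^ (-a)) := by
    intro k m
    have hr : 0 ≤ r1 (dyadicPoint k m) ^ (-a) := Real.rpow_nonneg (r1_pos _).le _
    have h1 : ((1 / 2 : ℝ) ^ k) ^ (β * p) = ((1 / 2) ^ (β * p)) ^ k :=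
      (Real.rpow_pow_comm (by norm_num) _ k).symm
    rw [hc, ← ENNReal.ofReal_mul (by positivity), ← ENNReal.ofReal_mul (by positivity),
      ← ENNReal.ofReal_mul' (by positivity), ← ENNReal.ofReal_mul' hr,
      Real.mul_rpow (by positivity) (by positivity), h1, hρ, mul_pow]
    congr 1
    ring
  have hratio : ENNReal.ofReal ρ * 2 ^ d < 1 := by
    have h1 : ρ * 2 ^ d < 1 := by
      rw [hρ, one_div, Real.inv_rpow two_pos.le, ← Real.rpow_neg two_pos.le,
        ← Real.rpow_natCast 2 d, ← Real.rpow_add two_pos, ← Real.rpow_add two_pos]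
      refine Real.rpow_lt_one_of_one_lt_of_neg one_lt_two ?_
      have h2 : δ * p < (β - d / p) * p := by gcongr
      rw [sub_mul, div_mul_cancel₀ _ hp.ne'] at h2
      linarith
    calc ENNReal.ofReal ρ * 2 ^ d = ENNReal.ofReal (ρ * 2 ^ d) := by
          rw [ENNReal.ofReal_mul hρ0, ENNReal.ofReal_pow two_pos.le]
          simp
      _ < 1 := by
          rw [← ENNReal.ofReal_one]
          exact (ENNReal.ofReal_lt_ofReal_iff one_pos).2 h1
  refine ne_top_of_le_ne_top (b := (3 ^ d * c * C) * ∑' k : ℕ, (ENNReal.ofReal ρ * 2 ^ d) ^ k)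
    ?_ ?_
  · rw [ENNReal.tsum_geometric]
    refine ENNReal.mul_ne_top (ENNReal.mul_ne_top (ENNReal.mul_ne_top
      (ENNReal.pow_ne_top (by simp))
      (ENNReal.mul_ne_top ENNReal.ofReal_ne_top ENNReal.ofReal_ne_top)) hC) ?_
    exact ENNReal.inv_ne_top.2 (tsub_pos_of_lt hratio).ne'
  · rw [ENNReal.tsum_prod', ← ENNReal.tsum_mul_left]
    refine ENNReal.tsum_le_tsum fun k => ?_
    rw [ENNReal.tsum_prod']
    simp only [hterm]
    simp only [tsum_fintype, Finset.sum_const, nsmul_eq_mul, Finset.card_univ, Fintype.card_fun,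
      Fintype.card_fin, ENNReal.tsum_mul_left]
    have h3 : Fintype.card SignType = 3 := rfl
    rw [h3]
    push_cast
    calc 3 ^ d * (c * ENNReal.ofReal (ρ ^ k) *
          ∑' m : Fin d → ℤ, ENNReal.ofReal (r1 (dyadicPoint k m) ^ (-a)))
        ≤ 3 ^ d * (c * ENNReal.ofReal (ρ ^ k) * (C * (2 ^ k) ^ d)) := by
          gcongr
          exact hsum k
      _ = _ := by
          rw [ENNReal.ofReal_pow hρ0]
          ring

end DyadicBounds

/-- If a sequence of random fields `X⁽ⁿ⁾` satisfies the Kolmogorov-type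
moment bounds uniformly in `n` and `E‖X⁽ⁿ⁾(x)‖^p → 0` for every `x`, then for any
`δ ∈ (0, β − d/p)` and `ε > d/p`, for any choice of modifications `Y⁽ⁿ⁾` of
`r₁^{−(l+ε)}X⁽ⁿ⁾` with sample paths in `C^δ(ℝ^d;V)`, one has
`E[|Y⁽ⁿ⁾|_{δ;V}^p] → 0`. -/
theorem stmt_4 (d : ℕ) (hd : 1 ≤ d) (p l β : ℝ) (hp : 1 ≤ p) (hl : 0 ≤ l)
    (hβ : β ∈ Set.Ioc (0 : ℝ) 1) (hβp : (d : ℝ) < β * p)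
    (δ ε : ℝ) (hδ : δ ∈ Set.Ioo (0 : ℝ) (β - d / p)) (hε : (d : ℝ) / p < ε)
    (Ω : Type u) [MeasurableSpace Ω] (P : Measure Ω) [IsProbabilityMeasure P]
    (V : Type v) [NormedAddCommGroup V] [NormedSpace ℝ V] [CompleteSpace V]
    (X : ℕ → Ω → EuclideanSpace ℝ (Fin d) → V)
    (hXmeas : ∀ n, StronglyMeasurable (Function.uncurry (X n)))
    (Nbar : ℝ) (hNbar : 0 < Nbar)
    (hmom : ∀ n x,
      ∫⁻ ω, (‖X n ω x‖₊ : ℝ≥0∞) ^ p ∂P ≤ ENNReal.ofReal (Nbar * r1 x ^ (l * p)))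
    (hdiff : ∀ n x y,
      ∫⁻ ω, (‖X n ω x - X n ω y‖₊ : ℝ≥0∞) ^ p ∂P ≤
        ENNReal.ofReal (Nbar * (r1 x ^ (l * p) + r1 y ^ (l * p)) * ‖x - y‖ ^ (β * p)))
    (hconv : ∀ x,
      Tendsto (fun n => ∫⁻ ω, (‖X n ω x‖₊ : ℝ≥0∞) ^ p ∂P) atTop (nhds 0))
    (Y : ℕ → Ω → EuclideanSpace ℝ (Fin d) → V)
    (hmod : ∀ n x, ∀ᵐ ω ∂P, Y n ω x = (r1 x ^ (-(l + ε))) • X n ω x)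
    (hpaths : ∀ n ω, Continuous (Y n ω) ∧ hNormE δ (Y n ω) ≠ ⊤) :
    Tendsto (fun n => ∫⁻ ω, hNormE δ (Y n ω) ^ p ∂P) atTop (nhds 0) := by
  have hp0 : 0 < p := zero_lt_one.trans_le hp
  have hε0 : 0 < ε := lt_of_le_of_lt (by positivity) hε
  have hεp : (d : ℝ) < ε * p := by rwa [div_lt_iff₀ hp0] at hε
  have hD : (1 : ℝ) ≤ √d := by
    rw [Real.one_le_sqrt]
    exact_mod_cast hd
  have hXae : ∀ n x, AEStronglyMeasurable (fun ω => X n ω x) P := fun n x =>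
    ((hXmeas n).comp_measurable measurable_prodMk_right).aestronglyMeasurable
  have hYae : ∀ n x, AEStronglyMeasurable (fun ω => Y n ω x) P := fun n x =>
    ((hXae n x).const_smul (r1 x ^ (-(l + ε)))).congr ((hmod n x).mono fun _ h => h.symm)
  have hYdiff : ∀ n x y, ∫⁻ ω, ‖Y n ω x - Y n ω y‖ₑ ^ p ∂P =
      ∫⁻ ω, ‖r1 x ^ (-(l + ε)) • X n ω x - r1 y ^ (-(l + ε)) • X n ω y‖ₑ ^ p ∂P := by
    intro n x y
    refine lintegral_congr_ae ?_
    filter_upwards [hmod n x, hmod n y] with ω h1 h2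
    rw [h1, h2]
  have hYmom : ∀ n x, ∫⁻ ω, ‖Y n ω x‖ₑ ^ p ∂P =
      ENNReal.ofReal ((r1 x ^ (-(l + ε))) ^ p) * ∫⁻ ω, ‖X n ω x‖ₑ ^ p ∂P := by
    intro n x
    have hw : 0 ≤ r1 x ^ (-(l + ε)) := Real.rpow_nonneg (r1_pos x).le _
    rw [← lintegral_const_mul' _ _ ENNReal.ofReal_ne_top]
    refine lintegral_congr_ae ?_
    filter_upwards [hmod n x] with ω h1
    rw [h1, enorm_smul, ENNReal.mul_rpow_of_nonneg _ _ hp0.le, ← ofReal_norm (r1 x ^ _),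
      Real.norm_of_nonneg hw, ENNReal.ofReal_rpow_of_nonneg hw hp0.le]
  obtain ⟨K, hK⟩ : ∃ K : ℝ, 0 ≤ K ∧ ∀ n x y, ‖x - y‖ ≤ √d →
      ∫⁻ ω, ‖Y n ω x - Y n ω y‖ₑ ^ p ∂P ≤
        ENNReal.ofReal (K * r1 x ^ (-(ε * p)) * ‖x - y‖ ^ (β * p)) :=
    ⟨_, by positivity, fun n x y hxy => (hYdiff n x y).trans_le
      (lintegral_enorm_weighted_sub_rpow_le hp hl hε0.le hβ hNbar.le hD (hXae n x) (hXae n y) hxy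
        (hmom n y) (hdiff n x y))⟩
  have hYlim : ∀ x, Tendsto (fun n => ∫⁻ ω, ‖Y n ω x‖ₑ ^ p ∂P) atTop (nhds 0) := by
    intro x
    simp_rw [hYmom]
    have h := ENNReal.Tendsto.const_mul (hconv x)
      (Or.inr (ENNReal.ofReal_ne_top (r := (r1 x ^ (-(l + ε))) ^ p)))
    rw [mul_zero] at h
    exact h
  have hYdifflim : ∀ x y, Tendsto (fun n => ∫⁻ ω, ‖Y n ω x - Y n ω y‖ₑ ^ p ∂P) atTop (nhds 0) := by
    intro x y
    have h2 : (2 : ℝ≥0∞) ^ (p - 1) ≠ ⊤ :=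
      ENNReal.rpow_ne_top_of_nonneg (sub_nonneg.2 hp) ENNReal.ofNat_ne_top
    have h3 := ENNReal.Tendsto.const_mul ((hYlim x).add (hYlim y)) (Or.inr h2)
    rw [add_zero, mul_zero] at h3
    refine tendsto_of_tendsto_of_tendsto_of_le_of_le tendsto_const_nhds h3
      (fun _ => zero_le) fun n => ?_
    simpa [sub_eq_add_neg] using lintegral_enorm_smul_add_smul_rpow_le hp (hYae n x)
      (G := fun ω => Y n ω y) 1 (-1)
  obtain ⟨C, hC, hCY⟩ := exists_hNormE_rpow_le_tsum (d := d) (V := V) hδ.1 hp0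
  have hvalues : Tendsto (fun n => ∑' m : Fin d → ℤ, ∫⁻ ω, ‖Y n ω (dyadicPoint 0 m)‖ₑ ^ p ∂P)
      atTop (nhds 0) := by
    refine ENNReal.tendsto_tsum_of_dominated (bound := fun m =>
      ENNReal.ofReal Nbar * ENNReal.ofReal (r1 (dyadicPoint 0 m) ^ (-(ε * p))))
      (fun n m => ?_) ?_ fun m => hYlim _
    · have hw : 0 ≤ (r1 (dyadicPoint 0 m) ^ (-(l + ε))) ^ p :=
        Real.rpow_nonneg (Real.rpow_nonneg (r1_pos _).le _) _
      rw [hYmom, ← ENNReal.ofReal_mul hNbar.le, ← r1_rpow_neg_add_rpow_mul _ l, mul_left_comm,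
        ENNReal.ofReal_mul hw]
      exact mul_le_mul_right (hmom n _) _
    · rw [ENNReal.tsum_mul_left]
      exact ENNReal.mul_ne_top ENNReal.ofReal_ne_top (tsum_r1_intPoint_rpow_ne_top hεp)
  have hincr : Tendsto (fun n => ∑' z : ℕ × (Fin d → ℤ) × (Fin d → SignType),
      ENNReal.ofReal ((2 ^ (δ * p)) ^ z.1) * ∫⁻ ω, ‖Y n ω (dyadicPoint z.1 z.2.1) -
        Y n ω (dyadicPoint z.1 (z.2.1 + fun i => (z.2.2 i : ℤ)))‖ₑ ^ p ∂P) atTop (nhds 0) := by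
    refine ENNReal.tendsto_tsum_of_dominated (fun n z => ?_)
      (tsum_dyadic_increment_bound_ne_top (K := K) hp0 hεp hδ.2) fun z => ?_
    · have h1 := norm_dyadicPoint_sub_add_le z.1 z.2.1 z.2.2
      have h2 : √d * (1 / 2) ^ z.1 ≤ √d :=
        mul_le_of_le_one_right (by positivity) (pow_le_one₀ (by norm_num) (by norm_num))
      have h3 : 0 ≤ r1 (dyadicPoint z.1 z.2.1) ^ (-(ε * p)) := Real.rpow_nonneg (r1_pos _).le _
      refine mul_le_mul_right ((hK.2 n _ _ (h1.trans h2)).trans (ENNReal.ofReal_le_ofReal ?_)) _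
      exact mul_le_mul_of_nonneg_left
        (Real.rpow_le_rpow (norm_nonneg _) h1 (mul_nonneg hβ.1.le hp0.le))
        (mul_nonneg hK.1 h3)
    · simpa using ENNReal.Tendsto.const_mul (hYdifflim _ _) (Or.inr ENNReal.ofReal_ne_top)
  have hlim := ENNReal.Tendsto.const_mul (hvalues.add hincr) (Or.inr hC)
  rw [add_zero, mul_zero] at hlim
  refine tendsto_of_tendsto_of_tendsto_of_le_of_le tendsto_const_nhds hlim
    (fun _ => zero_le) fun n => ?_
  refine (lintegral_mono fun ω => hCY (Y n ω) (hpaths n ω).1).trans_eq ?_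
  have hm1 : ∀ m : Fin d → ℤ, AEMeasurable (fun ω => ‖Y n ω (dyadicPoint 0 m)‖ₑ ^ p) P :=
    fun m => (hYae n _).enorm.pow_const p
  have hm2 : ∀ z : ℕ × (Fin d → ℤ) × (Fin d → SignType),
      AEMeasurable (fun ω => ENNReal.ofReal ((2 ^ (δ * p)) ^ z.1) *
        ‖Y n ω (dyadicPoint z.1 z.2.1) -
          Y n ω (dyadicPoint z.1 (z.2.1 + fun i => (z.2.2 i : ℤ)))‖ₑ ^ p) P :=
    fun z => (((hYae n _).sub (hYae n _)).enorm.pow_const p).const_mul _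
  rw [lintegral_const_mul' _ _ hC, lintegral_add_left' (AEMeasurable.tsum hm1),
    lintegral_tsum hm1, lintegral_tsum hm2]
  simp_rw [lintegral_const_mul' _ _ ENNReal.ofReal_ne_top]
end
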